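/- Let ℓ ≥ 4 be an integer and let k be the smallest integer greater than 2 that does not divide ℓ; assume k ≥ 5. If S is a multiset of k − 1 non-zero elements of ℤ/kℤ, then there exists a sub-multiset S' of S whose elements sum to the residue of ℓ modulo k. -/

import Mathlib

/-- The outdegree of a vertex `v` in the directed graph with edge relation `E`. -/
noncomputable def outDeg {n : ℕ} (E : Fin n → Fin n → Prop) (v : Fin n) : ℕ :=
  {w | E v w}.ncard

/-- The indegree of a vertex `v` in the directed graph with edge relation `E`. -/
noncomputable def inDeg {n : ℕ} (E : Fin n → Fin n → Prop) (v : Fin n) : ℕ :=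
  {w | E w v}.ncard

/-- The semidegree of a vertex: the minimum of its outdegree and indegree. -/
noncomputable def semiDeg {n : ℕ} (E : Fin n → Fin n → Prop) (v : Fin n) : ℕ :=
  min (outDeg E v) (inDeg E v)

/-- `E` is an oriented graph: no loops and no pair of opposite edges. -/
def Oriented {n : ℕ} (E : Fin n → Fin n → Prop) : Prop :=
  (∀ v, ¬ E v v) ∧ (∀ u v, E u v → ¬ E v u)

/-- The graph contains a directed cycle of length exactly `t`:
`t` distinct vertices cyclically joined by edges. -/
def HasDiCycle {n : ℕ} (E : Fin n → Fin n → Prop) (t : ℕ) : Prop :=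
  ∃ v : ZMod t → Fin n, Function.Injective v ∧ ∀ i, E (v i) (v (i + 1))

/-- The graph contains a closed directed walk of length `t` (vertices may repeat). -/
def HasClosedWalk {n : ℕ} (E : Fin n → Fin n → Prop) (t : ℕ) : Prop :=
  ∃ w : ℕ → Fin n, w 0 = w t ∧ ∀ i < t, E (w i) (w (i + 1))

/-- There is a directed path of length `t` from `x` to `y` (all vertices distinct). -/
def HasPath {n : ℕ} (E : Fin n → Fin n → Prop) (x y : Fin n) (t : ℕ) : Prop :=
  ∃ u : Fin (t + 1) → Fin n, Function.Injective u ∧ u 0 = x ∧ u (Fin.last t) = y ∧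
    ∀ i : Fin t, E (u i.castSucc) (u i.succ)

/-- The graph contains an `s`-shortcut: a directed path `v₀ v₁ ⋯ v_s` on distinct
vertices together with the additional edge `v₀ v_s`. -/
def HasShortcut {n : ℕ} (E : Fin n → Fin n → Prop) (s : ℕ) : Prop :=
  ∃ v : Fin (s + 1) → Fin n, Function.Injective v ∧
    (∀ i : Fin s, E (v i.castSucc) (v i.succ)) ∧ E (v 0) (v (Fin.last s))

/-- The graph is homomorphic to the directed cycle `C_k`. -/
def HomToCycle {n : ℕ} (E : Fin n → Fin n → Prop) (k : ℕ) : Prop :=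
  ∃ f : Fin n → ZMod k, ∀ u v, E u v → f v = f u + 1

/-- The finset of sums of sub-multisets of `S`. -/
def subsetSums {G : Type*} [AddCommMonoid G] [DecidableEq G] (S : Multiset G) : Finset G :=
  (S.powerset.map Multiset.sum).toFinset

theorem mem_subsetSums {G : Type*} [AddCommMonoid G] [DecidableEq G] {S : Multiset G} {g : G} :
    g ∈ subsetSums S ↔ ∃ T ≤ S, T.sum = g := by
  simp [subsetSums]

theorem subsetSums_subset_cons {G : Type*} [AddCommMonoid G] [DecidableEq G] (a : G)
    (S : Multiset G) : subsetSums S ⊆ subsetSums (a ::ₘ S) := by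
  intro g hg
  obtain ⟨T, hT, rfl⟩ := mem_subsetSums.1 hg
  exact mem_subsetSums.2 ⟨T, hT.trans (Multiset.le_cons_self S a), rfl⟩

theorem add_mem_subsetSums_cons {G : Type*} [AddCommMonoid G] [DecidableEq G] {a g : G}
    {S : Multiset G} (hg : g ∈ subsetSums S) : g + a ∈ subsetSums (a ::ₘ S) := by
  obtain ⟨T, hT, rfl⟩ := mem_subsetSums.1 hg
  exact mem_subsetSums.2 ⟨a ::ₘ T, Multiset.cons_le_cons a hT, by rw [Multiset.sum_cons, add_comm]⟩

/-- Either `S` has more than `card S` distinct subset sums, or all multiples of some element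
of `S` are subset sums. -/
theorem card_lt_card_subsetSums_or_exists_nsmul_mem {G : Type*} [AddCommMonoid G] [DecidableEq G]
    (S : Multiset G) :
    Multiset.card S < (subsetSums S).card ∨ ∃ x ∈ S, ∀ n : ℕ, n • x ∈ subsetSums S := by
  induction S using Multiset.induction with
  | empty => exact Or.inl (Finset.card_pos.2 ⟨0, mem_subsetSums.2 ⟨0, le_rfl, rfl⟩⟩)
  | cons a S ih =>
    rcases ih with hlt | ⟨x, hx, hmul⟩
    · by_cases hstable : ∀ s ∈ subsetSums S, s + a ∈ subsetSums S
      · refine Or.inr ⟨a, Multiset.mem_cons_self a S, fun n => subsetSums_subset_cons a S ?_⟩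
        induction n with
        | zero => exact mem_subsetSums.2 ⟨0, Multiset.zero_le S, by simp⟩
        | succ n ihn => rw [succ_nsmul]; exact hstable _ ihn
      · push Not at hstable
        obtain ⟨s, hs, hsa⟩ := hstable
        left
        have hcard := Finset.card_le_card (Finset.insert_subset (add_mem_subsetSums_cons hs)
          (subsetSums_subset_cons a S))
        rw [Finset.card_insert_of_notMem hsa] at hcard
        rw [Multiset.card_cons]
        omega
    · exact Or.inr ⟨x, Multiset.mem_cons_of_mem hx, fun n => subsetSums_subset_cons a S (hmul n)⟩

/-- If `gcd (x, k)` divides `l`, then the residue of `l` is a multiple of `x` in `ZMod k`. -/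
theorem ZMod.exists_nsmul_eq_natCast {k : ℕ} [NeZero k] {x : ZMod k} {l : ℕ}
    (h : x.val.gcd k ∣ l) : ∃ n : ℕ, n • x = (l : ZMod k) := by
  obtain ⟨m, rfl⟩ := h
  refine ⟨((x.val.gcdA k * m : ℤ) : ZMod k).val, ?_⟩
  have hbez := congrArg (Int.cast : ℤ → ZMod k) (Nat.gcd_eq_gcd_ab x.val k)
  push_cast [ZMod.natCast_self, ZMod.natCast_zmod_val] at hbez
  rw [nsmul_eq_mul, ZMod.natCast_zmod_val]
  push_cast
  rw [hbez]
  ring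

/-- Let `ℓ ≥ 4` and let `k ≥ 5` be the smallest integer greater than `2` not dividing
`ℓ`. Every multiset of `k - 1` non-zero elements of `ℤ/kℤ` has a sub-multiset whose sum
is the residue of `ℓ` modulo `k`. -/
theorem submultiset_sum_residue (ℓ k : ℕ) (hℓ : 4 ≤ ℓ)
    (hk2 : 2 < k) (hkd : ¬ k ∣ ℓ) (hkmin : ∀ m : ℕ, 2 < m → ¬ m ∣ ℓ → k ≤ m) (hk5 : 5 ≤ k)
    (S : Multiset (ZMod k)) (hcard : Multiset.card S = k - 1) (hS : ∀ x ∈ S, x ≠ 0) :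
    ∃ S' : Multiset (ZMod k), S' ≤ S ∧ S'.sum = (ℓ : ZMod k) := by
  have : NeZero k := ⟨by omega⟩
  suffices h : (ℓ : ZMod k) ∈ subsetSums S from mem_subsetSums.1 h
  rcases card_lt_card_subsetSums_or_exists_nsmul_mem S with hlt | ⟨x, hx, hmul⟩
  · have huniv : subsetSums S = Finset.univ := by
      apply Finset.eq_univ_of_card
      have hle := Finset.card_le_univ (subsetSums S)
      rw [ZMod.card] at hle ⊢
      omega
    rw [huniv]
    exact Finset.mem_univ _
  · have hdvd : x.val.gcd k ∣ ℓ := by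
      by_contra hd
      have hpos : 0 < x.val := Nat.pos_of_ne_zero ((ZMod.val_ne_zero x).2 (hS x hx))
      have hgt : x.val.gcd k < k := (Nat.gcd_le_left k hpos).trans_lt x.val_lt
      have hle : x.val.gcd k ≤ 2 := by
        by_contra! h2
        exact absurd (hkmin _ h2 hd) (by omega)
      have h4 : 4 ∣ ℓ := by
        by_contra h4
        exact absurd (hkmin 4 (by norm_num) h4) (by omega)
      have hgcd : 0 < x.val.gcd k := Nat.gcd_pos_of_pos_left k hpos
      generalize x.val.gcd k = d at *
      interval_cases d <;> omega
    obtain ⟨n, hn⟩ := ZMod.exists_nsmul_eq_natCast hdvd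
    exact hn ▸ hmul n
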